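/- Fix integers d ≥ 2 and D ≥ 0. For each N set M = N + D and, for j ∈ {0,…,N}, let c_bay(j) = [4d + (D+2j)(D+2j+2) + 2(M+N) − (M+N)² + 4MN]/(4(d+M)(d+N)) be the optimal Bayesian estimator and c_loc(j) = ((D+2j)/(M+N))² the optimal local estimator. Then the two estimators agree asymptotically, uniformly over outcomes: lim_{N→∞} max_{0 ≤ j ≤ N} | c_bay(j) − c_loc(j) | = 0. -/

import Mathlib

open Finset Filter

/-- The optimal Bayesian estimator for outcome `j`, with `N` and `M = N + D` copies in
dimension `d`: `c_bay(j) = (4d + (D+2j)(D+2j+2) + 2(M+N) − (M+N)² + 4MN)/(4(d+M)(d+N))`. -/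
noncomputable def cBay (d D N j : ℕ) : ℝ :=
  (4 * (d : ℝ) + ((D : ℝ) + 2 * j) * ((D : ℝ) + 2 * j + 2)
      + 2 * (((N : ℝ) + D) + N) - (((N : ℝ) + D) + N) ^ 2 + 4 * ((N : ℝ) + D) * N) /
    (4 * ((d : ℝ) + ((N : ℝ) + D)) * ((d : ℝ) + N))

/-- The optimal local estimator `c_loc(j) = ((D+2j)/(M+N))²` with `M = N + D`. -/
noncomputable def cLoc (D N j : ℕ) : ℝ :=
  (((D : ℝ) + 2 * j) / (((N : ℝ) + D) + N)) ^ 2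

/-- Quantitative form of the asymptotic agreement of the two estimators: their difference is
`O(1/N)`, with a constant that does not depend on the outcome `j ≤ N`. -/
theorem abs_cBay_sub_cLoc_le (d D N j : ℕ) (hN : 1 ≤ N) (hj : j ≤ N) :
    |cBay d D N j - cLoc D N j| ≤ (4 * (d : ℝ) ^ 2 + 8 * d + 4 + 2 * (D : ℝ) ^ 2) / N := by
  unfold cBay cLoc
  have hN' : (1 : ℝ) ≤ N := by exact_mod_cast hN
  have hj' : (j : ℝ) ≤ N := by exact_mod_cast hj
  have hj0 : (0 : ℝ) ≤ j := j.cast_nonneg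
  have hd0 : (0 : ℝ) ≤ d := d.cast_nonneg
  have hD0 : (0 : ℝ) ≤ D := D.cast_nonneg
  generalize (N : ℝ) = n at *
  generalize (j : ℝ) = i at *
  generalize (d : ℝ) = a at *
  generalize (D : ℝ) = b at *
  set x := b + 2 * i with hx
  set s := n + b + n with hs
  set Q := 4 * (a + (n + b)) * (a + n) with hQ
  have hx0 : 0 ≤ x := by positivity
  have hxs : x ≤ s := by linarith
  have hs1 : 1 ≤ s := by linarith
  have hs0 : 0 < s := by linarith
  have hQs : s * n ≤ Q := by
    rw [hQ, hs]
    nlinarith [mul_nonneg hd0 hd0, mul_nonneg hd0 hD0, mul_nonneg hd0 (by linarith : 0 ≤ n),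
      mul_nonneg hD0 (by linarith : 0 ≤ n), mul_self_nonneg n]
  have hQ0 : 0 < Q := by positivity
  have hr0 : 0 ≤ (x / s) ^ 2 := by positivity
  have hr1 : (x / s) ^ 2 ≤ 1 := pow_le_one₀ (by positivity) ((div_le_one hs0).2 hxs)
  have hxr : x ^ 2 = (x / s) ^ 2 * s ^ 2 := by field_simp
  have key : (4 * a + x * (x + 2) + 2 * s - s ^ 2 + 4 * (n + b) * n) / Q - (x / s) ^ 2 =
      (4 * a + 2 * x + 2 * s - b ^ 2 - (x / s) ^ 2 * (4 * a ^ 2 + 4 * a * s - b ^ 2)) / Q := by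
    rw [div_sub' hQ0.ne']
    congr 1
    generalize (x / s) ^ 2 = r at *
    rw [mul_add, ← sq, hxr, hQ, hs]
    ring
  rw [key, abs_div, abs_of_pos hQ0, div_le_div_iff₀ hQ0 (by linarith)]
  have hnum : |4 * a + 2 * x + 2 * s - b ^ 2 - (x / s) ^ 2 * (4 * a ^ 2 + 4 * a * s - b ^ 2)| ≤
      (4 * a ^ 2 + 8 * a + 4 + 2 * b ^ 2) * s := by
    generalize (x / s) ^ 2 = r at *
    have h1 : 0 ≤ r * (4 * a ^ 2 + 4 * a * s) := by positivity
    have h2 : r * (4 * a ^ 2 + 4 * a * s) ≤ 4 * a ^ 2 + 4 * a * s :=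
      mul_le_of_le_one_left (by positivity) hr1
    have h3 : 0 ≤ r * b ^ 2 := by positivity
    have h4 : r * b ^ 2 ≤ b ^ 2 := mul_le_of_le_one_left (by positivity) hr1
    have h5 : 4 * a ^ 2 + 4 * a + 2 * b ^ 2 ≤ (4 * a ^ 2 + 4 * a + 2 * b ^ 2) * s :=
      le_mul_of_one_le_right (by positivity) hs1
    have h6 : 0 ≤ b ^ 2 := by positivity
    rw [abs_le]
    constructor <;> nlinarith
  calc _ ≤ (4 * a ^ 2 + 8 * a + 4 + 2 * b ^ 2) * s * n :=
        mul_le_mul_of_nonneg_right hnum (by linarith)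
    _ = (4 * a ^ 2 + 8 * a + 4 + 2 * b ^ 2) * (s * n) := by ring
    _ ≤ _ := mul_le_mul_of_nonneg_left hQs (by positivity)

/-- Fix `d ≥ 2` and `D ≥ 0`. With `M = N + D`, the optimal Bayesian estimator and the
optimal local estimator agree asymptotically, uniformly over outcomes `j ∈ {0,…,N}`:
`lim_{N→∞} max_{0≤j≤N} |c_bay(j) − c_loc(j)| = 0`. -/
theorem bayesian_and_local_estimators_agree (d D : ℕ) (hd : 2 ≤ d) :
    Tendsto (fun N : ℕ =>
        (Finset.range (N + 1)).sup'
          (Finset.nonempty_range_iff.mpr (Nat.succ_ne_zero N))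
          (fun j => |cBay d D N j - cLoc D N j|))
      atTop (nhds 0) := by
  refine squeeze_zero' (Eventually.of_forall fun N => ?_) ?_
    (tendsto_const_div_atTop_nhds_zero_nat (4 * (d : ℝ) ^ 2 + 8 * d + 4 + 2 * (D : ℝ) ^ 2))
  · exact (abs_nonneg _).trans
      (Finset.le_sup' (fun j => |cBay d D N j - cLoc D N j|) (Finset.mem_range.2 N.succ_pos))
  · filter_upwards [eventually_ge_atTop 1] with N hN
    exact Finset.sup'_le _ _ fun j hj =>
      abs_cBay_sub_cLoc_le d D N j hN (Nat.lt_succ_iff.1 (Finset.mem_range.1 hj))
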